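/- arXiv:math/0212295 — 4 statements merged into one kernel-verified Lean document; each statement's English description precedes it below -/
import Mathlib

section
/- The ring ℤ((t)) = ℤ[[t]][t⁻¹] of formal Laurent series with integer coefficients and finite principal part (series Σ_{n ≥ N} a_n tⁿ with N ∈ ℤ and a_n ∈ ℤ) is a principal ideal domain. -/
/-- A prime ideal of `R⟦X⟧` not containing `X` is principal when `R` is a principal ideal ring. -/
theorem PowerSeries.isPrincipal_of_isPrime_of_X_notMem {R : Type*} [CommRing R]
    [IsPrincipalIdealRing R] {P : Ideal (PowerSeries R)} [P.IsPrime]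
    (hX : PowerSeries.X ∉ P) : P.IsPrincipal := by
  obtain ⟨a, ha⟩ := (IsPrincipalIdealRing.principal (P.map PowerSeries.constantCoeff)).principal
  obtain ⟨T, hT, -, hcard⟩ :=
    PowerSeries.exist_eq_span_eq_ncard_of_X_notMem hX ha.symm (Set.finite_singleton a)
  rw [Set.ncard_singleton, Set.ncard_eq_one] at hcard
  obtain ⟨f, rfl⟩ := hcard
  exact ⟨f, hT⟩

/-- Laurent series over a principal ideal ring form a principal ideal ring. -/
theorem LaurentSeries.isPrincipalIdealRing (R : Type*) [CommRing R] [IsPrincipalIdealRing R] :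
    IsPrincipalIdealRing (LaurentSeries R) := by
  refine IsPrincipalIdealRing.of_prime fun P hP ↦ ?_
  let M := Submonoid.powers (PowerSeries.X : PowerSeries R)
  obtain ⟨hprime, hdisj⟩ := (IsLocalization.isPrime_iff_isPrime_disjoint M _ P).mp hP
  have hX : PowerSeries.X ∉ P.comap (algebraMap (PowerSeries R) (LaurentSeries R)) :=
    Set.disjoint_left.mp hdisj (Submonoid.mem_powers _)
  obtain ⟨f, hf⟩ := (PowerSeries.isPrincipal_of_isPrime_of_X_notMem hX).principal
  refine ⟨algebraMap _ _ f, ?_⟩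
  rw [← IsLocalization.map_under M (LaurentSeries R) P, Ideal.under, hf, Ideal.submodule_span_eq,
    Ideal.map_span, Set.image_singleton, Ideal.submodule_span_eq]


/-- STATEMENT 13: The ring `ℤ((t)) = ℤ[[t]][t⁻¹]` of formal Laurent series with integer
coefficients and finite principal part is a principal ideal domain.  (In Mathlib,
`LaurentSeries ℤ = HahnSeries ℤ ℤ` consists exactly of the formal series `Σ aₙ tⁿ`
with support bounded below.) -/
theorem laurentSeries_int_isPrincipalIdealDomain :
    IsDomain (LaurentSeries ℤ) ∧ IsPrincipalIdealRing (LaurentSeries ℤ) := by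
  exact ⟨inferInstance, LaurentSeries.isPrincipalIdealRing ℤ⟩
end

section
/- Let Y be a Hausdorff topological space and f : Y → ℝ a continuous function. A closed set A ⊆ Y is compact/forward for f if and only if A ∩ B is compact for every closed backward set B ⊆ Y. -/
/-- A set `A ⊆ Y` is *slab compact* for `f : Y → ℝ` if `A ∩ f⁻¹([b,c])` is compact for
all reals `b ≤ c`. -/
def IsSlabCompactSet {Y : Type*} [TopologicalSpace Y] (f : Y → ℝ) (A : Set Y) : Prop :=
  ∀ b c : ℝ, b ≤ c → IsCompact (A ∩ f ⁻¹' Set.Icc b c)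

/-- A set `A ⊆ Y` is *forward* for `f` if `A ⊆ f⁻¹([a,∞))` for some real `a`. -/
def IsForwardSet {Y : Type*} (f : Y → ℝ) (A : Set Y) : Prop :=
  ∃ a : ℝ, A ⊆ f ⁻¹' Set.Ici a

/-- A set `A ⊆ Y` is *backward* for `f` if `A ⊆ f⁻¹((-∞,b])` for some real `b`. -/
def IsBackwardSet {Y : Type*} (f : Y → ℝ) (A : Set Y) : Prop :=
  ∃ b : ℝ, A ⊆ f ⁻¹' Set.Iic b

/-- A set is *compact/forward* (c/f) for `f` if it is both slab compact and forward. -/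
def IsCFSet {Y : Type*} [TopologicalSpace Y] (f : Y → ℝ) (A : Set Y) : Prop :=
  IsSlabCompactSet f A ∧ IsForwardSet f A

/-- STATEMENT 17: For a continuous `f` on a Hausdorff space, a closed set `A` is
compact/forward iff `A ∩ B` is compact for every closed backward set `B`. -/
theorem cf_iff_compact_inter_backward {Y : Type*} [TopologicalSpace Y] [T2Space Y]
    (f : Y → ℝ) (hf : Continuous f) (A : Set Y) (hA : IsClosed A) :
    IsCFSet f A ↔ ∀ B : Set Y, IsClosed B → IsBackwardSet f B → IsCompact (A ∩ B) := by
  constructor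
  · rintro ⟨hslab, a, ha⟩ B hB ⟨b, hb⟩
    have heq : A ∩ B = A ∩ f ⁻¹' Set.Icc a (max a b) ∩ B := by
      ext x
      constructor
      · rintro ⟨hxA, hxB⟩
        exact ⟨⟨hxA, ha hxA, le_max_of_le_right (hb hxB)⟩, hxB⟩
      · rintro ⟨⟨hxA, -⟩, hxB⟩
        exact ⟨hxA, hxB⟩
    rw [heq]
    exact (hslab a (max a b) (le_max_left a b)).inter_right hB
  · intro h
    refine ⟨fun b c _ => h _ (isClosed_Icc.preimage hf) ⟨c, fun x hx => hx.2⟩, ?_⟩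
    obtain ⟨m, hm⟩ :=
      (h (f ⁻¹' Set.Iic 0) (isClosed_Iic.preimage hf) ⟨0, subset_rfl⟩).bddBelow_image
        hf.continuousOn
    refine ⟨min m 0, fun x hx => ?_⟩
    rcases le_total (f x) 0 with hx0 | hx0
    · exact min_le_of_left_le (hm ⟨x, ⟨hx, hx0⟩, rfl⟩)
    · exact min_le_of_right_le hx0
end

section
/- Let Y be a topological space, f : Y → ℝ a continuous proper map (preimages of compact sets are compact), and t : Y → Y a homeomorphism satisfying f(t(y)) = f(y) + 1 for all y ∈ Y. Then a closed set A ⊆ Y is compact/forward for f if and only if there exist a compact set K ⊆ Y and an integer N such that A ⊆ ⋃_{n ≥ N} tⁿ(K). -/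
/-- A function shifted by one by a permutation is shifted by `n` by its `n`-th iterate. -/
theorem apply_zpow_eq_add_of_apply_eq_add_one {Y : Type*} {f : Y → ℝ} {t : Equiv.Perm Y}
    (hft : ∀ y : Y, f (t y) = f y + 1) (n : ℤ) (y : Y) : f ((t ^ n) y) = f y + n := by
  induction n with
  | zero => simp
  | succ n ih =>
    rw [add_comm, zpow_one_add, Equiv.Perm.mul_apply, hft, ih]
    push_cast
    ring
  | pred n ih =>
    have h := hft ((t ^ (-(n : ℤ) - 1)) y)
    rw [← Equiv.Perm.mul_apply, ← zpow_one_add, add_sub_cancel, ih] at h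
    push_cast at h ⊢
    linarith

/-- STATEMENT 18: Let `f : Y → ℝ` be continuous and proper and let `t` be a homeomorphism
of `Y` with `f(t y) = f y + 1`.  Then a closed set `A` is compact/forward for `f` iff
`A ⊆ ⋃_{n ≥ N} tⁿ(K)` for some compact `K` and integer `N`. -/
theorem cf_iff_union_translates {Y : Type*} [TopologicalSpace Y]
    (f : Y → ℝ) (hf : Continuous f)
    (hproper : ∀ K : Set ℝ, IsCompact K → IsCompact (f ⁻¹' K))
    (t : Equiv.Perm Y) (ht : Continuous t) (ht' : Continuous t.symm)
    (hft : ∀ y : Y, f (t y) = f y + 1)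
    (A : Set Y) (hA : IsClosed A) :
    IsCFSet f A ↔
      ∃ K : Set Y, IsCompact K ∧ ∃ N : ℤ, A ⊆ ⋃ n ∈ {n : ℤ | N ≤ n}, (t ^ n) '' K := by
  constructor
  · rintro ⟨-, a, ha⟩
    refine ⟨f ⁻¹' Set.Icc 0 1, hproper _ isCompact_Icc, ⌊a⌋, fun y hy => ?_⟩
    simp only [Set.mem_iUnion, Set.mem_ofPred_eq, exists_prop]
    refine ⟨⌊f y⌋, Int.floor_le_floor (ha hy), (t ^ (-⌊f y⌋)) y, ?_, ?_⟩
    · rw [Set.mem_preimage, apply_zpow_eq_add_of_apply_eq_add_one hft, Int.cast_neg,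
        ← sub_eq_add_neg]
      exact ⟨Int.fract_nonneg _, (Int.fract_lt_one _).le⟩
    · rw [← Equiv.Perm.mul_apply, ← zpow_add, add_neg_cancel, zpow_zero, Equiv.Perm.one_apply]
  · rintro ⟨K, hK, N, hAK⟩
    refine ⟨fun b c _ => (hproper _ isCompact_Icc).inter_left hA, ?_⟩
    obtain ⟨m, hm⟩ := (hK.image hf).bddBelow
    refine ⟨m + N, fun y hy => ?_⟩
    have h := hAK hy
    simp only [Set.mem_iUnion, Set.mem_ofPred_eq, exists_prop] at h
    obtain ⟨n, hn, k, hk, rfl⟩ := h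
    rw [Set.mem_preimage, apply_zpow_eq_add_of_apply_eq_add_one hft]
    exact add_le_add (hm (Set.mem_image_of_mem f hk)) (Int.cast_le.mpr hn)
end

section
/- Let the group ℤ^q act on a Hausdorff topological space Y by homeomorphisms n ↦ tⁿ, with the action properly discontinuous in the sense that {n ∈ ℤ^q : tⁿ(K') ∩ K'' ≠ ∅} is finite for all compact sets K', K'' ⊆ Y, and cocompact, i.e. there is a compact set K₀ ⊆ Y with Y = ⋃_{n ∈ ℤ^q} tⁿ(K₀). Let χ : ℤ^q → ℝ be an additive group homomorphism and f : Y → ℝ a continuous function satisfying f(tⁿ(y)) = f(y) + χ(n) for all n ∈ ℤ^q and y ∈ Y. Then a closed set A ⊆ Y is compact/forward for f if and only if there exist a compact set K ⊆ Y and a compact/forward subset F ⊆ ℤ^q (with respect to χ) such that A ⊆ ⋃_{n ∈ F} tⁿ(K). -/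
/-- For an additive homomorphism `χ : ℤ^q → ℝ`, a subset `F ⊆ ℤ^q` is compact/forward if
`F ∩ χ⁻¹([a,b])` is finite for all `a ≤ b` and `F ⊆ χ⁻¹([a,∞))` for some `a`. -/
def IsCFLattice (q : ℕ) (χ : (Fin q → ℤ) →+ ℝ) (F : Set (Fin q → ℤ)) : Prop :=
  (∀ a b : ℝ, a ≤ b → (F ∩ χ ⁻¹' Set.Icc a b).Finite) ∧ ∃ a : ℝ, F ⊆ χ ⁻¹' Set.Ici a

/-- A continuous real function on a compact set takes values in some `[-C, C]` with `0 ≤ C`. -/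
theorem IsCompact.exists_nonneg_abs_le {Y : Type*} [TopologicalSpace Y] {K : Set Y}
    (hK : IsCompact K) {f : Y → ℝ} (hf : Continuous f) :
    ∃ C : ℝ, 0 ≤ C ∧ ∀ y ∈ K, -C ≤ f y ∧ f y ≤ C := by
  obtain ⟨C, hC⟩ := hK.exists_bound_of_continuousOn hf.continuousOn
  exact ⟨|C|, abs_nonneg C, fun y hy => abs_le.mp ((hC y hy).trans (le_abs_self C))⟩

/-- STATEMENT 19: Let `ℤ^q` act on a Hausdorff space `Y` by homeomorphisms `n ↦ tⁿ`,
properly discontinuously and cocompactly, let `χ : ℤ^q → ℝ` be an additive homomorphism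
and `f : Y → ℝ` continuous with `f(tⁿ y) = f y + χ(n)`.  Then a closed set `A ⊆ Y` is
compact/forward for `f` iff `A ⊆ ⋃_{n ∈ F} tⁿ(K)` for some compact `K ⊆ Y` and some
compact/forward `F ⊆ ℤ^q`. -/
theorem cf_iff_union_lattice_translates {Y : Type*} [TopologicalSpace Y] [T2Space Y]
    (q : ℕ) (hq : 1 ≤ q)
    (t : (Fin q → ℤ) → Equiv.Perm Y)
    (ht_hom : ∀ m n : Fin q → ℤ, t (m + n) = (t m).trans (t n))
    (ht_cont : ∀ n, Continuous (t n)) (ht_cont' : ∀ n, Continuous (t n).symm)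
    (hpd : ∀ K' K'' : Set Y, IsCompact K' → IsCompact K'' →
      {n : Fin q → ℤ | ((t n) '' K' ∩ K'').Nonempty}.Finite)
    (K₀ : Set Y) (hK₀ : IsCompact K₀) (hcover : ∀ y : Y, ∃ n : Fin q → ℤ, y ∈ (t n) '' K₀)
    (χ : (Fin q → ℤ) →+ ℝ) (f : Y → ℝ) (hf : Continuous f)
    (hequiv : ∀ (n : Fin q → ℤ) (y : Y), f (t n y) = f y + χ n)
    (A : Set Y) (hA : IsClosed A) :
    IsCFSet f A ↔
      ∃ K : Set Y, IsCompact K ∧ ∃ F : Set (Fin q → ℤ), IsCFLattice q χ F ∧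
        A ⊆ ⋃ n ∈ F, (t n) '' K := by
  constructor
  · rintro ⟨hslab, a, ha⟩
    obtain ⟨C, hC0, hC⟩ := hK₀.exists_nonneg_abs_le hf
    refine ⟨K₀, hK₀, {n | ((t n) '' K₀ ∩ A).Nonempty}, ⟨fun b c hbc => ?_, a - C, ?_⟩, ?_⟩
    · refine (hpd K₀ _ hK₀ (hslab (b - C) (c + C) (by linarith))).subset ?_
      rintro n ⟨⟨_, ⟨k, hk, rfl⟩, hkA⟩, hb, hc⟩
      obtain ⟨hk₁, hk₂⟩ := hC k hk
      have hfk := hequiv n k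
      exact ⟨t n k, ⟨k, hk, rfl⟩, hkA, by linarith, by linarith⟩
    · rintro n ⟨_, ⟨k, hk, rfl⟩, hkA⟩
      have hfk := hequiv n k
      have hak : a ≤ f (t n k) := ha hkA
      have hk₂ := (hC k hk).2
      change a - C ≤ χ n
      linarith
    · intro y hy
      obtain ⟨n, hn⟩ := hcover y
      exact Set.mem_biUnion (show n ∈ {n | ((t n) '' K₀ ∩ A).Nonempty} from ⟨y, hn, hy⟩) hn
  · rintro ⟨K, hK, F, ⟨hfin, a, ha⟩, hAF⟩
    obtain ⟨C, hC0, hC⟩ := hK.exists_nonneg_abs_le hf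
    refine ⟨fun b c hbc => ?_, a - C, fun y hy => ?_⟩
    · refine ((hfin (b - C) (c + C) (by linarith)).isCompact_biUnion
        fun n _ => hK.image (ht_cont n)).of_isClosed_subset
          (hA.inter (isClosed_Icc.preimage hf)) ?_
      rintro y ⟨hy, hb, hc⟩
      obtain ⟨n, hn, k, hk, rfl⟩ := Set.mem_iUnion₂.mp (hAF hy)
      obtain ⟨hk₁, hk₂⟩ := hC k hk
      rw [hequiv n k] at hb hc
      exact Set.mem_biUnion (show n ∈ F ∩ χ ⁻¹' Set.Icc (b - C) (c + C) from
        ⟨hn, by linarith, by linarith⟩) ⟨k, hk, rfl⟩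
    · obtain ⟨n, hn, k, hk, rfl⟩ := Set.mem_iUnion₂.mp (hAF hy)
      have hk₁ := (hC k hk).1
      have han : a ≤ χ n := ha hn
      change a - C ≤ f (t n k)
      rw [hequiv n k]
      linarith
end
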